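/- arXiv:math/0207206 — 3 statements merged into one kernel-verified Lean document; each statement's English description precedes it below -/
import Mathlib

section
/- In U_q[gl(m|n)], for indices with b < a < c, the graded commutator satisfies [E^a_c, E^c_b] = E^a_b K_a^{-1} K_c. -/
/-!
U_q[gl(m|n)]: the quantum superalgebra presented by generators and relations,
following Zhang (1993).  We work over the field ℚ(q) of rational functions.
-/

noncomputable section

/-- The base field ℚ(q) of rational functions in the indeterminate q. -/
abbrev Fq : Type := RatFunc ℚ

/-- The indeterminate q. -/
def qq : Fq := RatFunc.X

/-- The ℤ₂-grading of an index: `[a] = 0` if `a ≤ m`, `[a] = 1` if `a > m`. -/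
def gr (m a : ℕ) : ℕ := if a ≤ m then 0 else 1

/-- `q_a = q^{(-1)^{[a]}}`. -/
def qi (m a : ℕ) : Fq := if a ≤ m then qq else qq⁻¹

/-- `Δ = q - q⁻¹`. -/
def Δq : Fq := qq - qq⁻¹

/-- `Δ_a = (-1)^{[a]} Δ`. -/
def Δi (m a : ℕ) : Fq := (-1 : Fq) ^ gr m a * Δq

/-- Kronecker delta, as an integer. -/
def δℤ (a b : ℕ) : ℤ := if a = b then 1 else 0

/-- The sign `(-1)^{[E^a_b][E^c_d]}`, where `[E^a_b] = [a] + [b] (mod 2)`. -/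
def sgn (m a b c d : ℕ) : Fq := (-1 : Fq) ^ ((gr m a + gr m b) * (gr m c + gr m d))

/-- The quantum superalgebra `U_q[gl(m|n)]`: a unital associative ℚ(q)-algebra with
invertible Cartan generators `K a` (`1 ≤ a ≤ m+n`) and generators `E a b`
(simple ones for `|a-b| = 1`, nonsimple ones defined recursively for `|a-b| > 1`),
subject to the defining relations below. -/
structure UqGl (m n : ℕ) where
  /-- the underlying carrier -/
  A : Type
  ringA : Ring A
  algA : Algebra Fq A
  /-- Cartan generators `K_a` -/
  K : ℕ → A
  /-- inverse Cartan generators `K_a⁻¹` -/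
  Kinv : ℕ → A
  /-- generators `E^a_b` -/
  E : ℕ → ℕ → A
  /-- (i) the Cartan generators commute -/
  K_comm : ∀ a b, 1 ≤ a → a ≤ m + n → 1 ≤ b → b ≤ m + n →
    K a * K b = K b * K a
  /-- (i) `K_a K_a⁻¹ = 1` -/
  K_Kinv : ∀ a, 1 ≤ a → a ≤ m + n → K a * Kinv a = 1
  /-- (i) `K_a⁻¹ K_a = 1` -/
  Kinv_K : ∀ a, 1 ≤ a → a ≤ m + n → Kinv a * K a = 1
  /-- (ii) `K_a E^b_{b+1} = q_a^{δ^a_b - δ^a_{b+1}} E^b_{b+1} K_a` -/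
  K_E_raise : ∀ a b, 1 ≤ a → a ≤ m + n → 1 ≤ b → b + 1 ≤ m + n →
    K a * E b (b+1) = (qi m a ^ (δℤ a b - δℤ a (b+1))) • (E b (b+1) * K a)
  /-- (ii) `K_a E^{b+1}_b = q_a^{δ^a_{b+1} - δ^a_b} E^{b+1}_b K_a` -/
  K_E_lower : ∀ a b, 1 ≤ a → a ≤ m + n → 1 ≤ b → b + 1 ≤ m + n →
    K a * E (b+1) b = (qi m a ^ (δℤ a (b+1) - δℤ a b)) • (E (b+1) b * K a)
  /-- (iii) `[E^a_{a+1}, E^{b+1}_b] = δ^a_b Δ_a⁻¹ (K_a K_{a+1}⁻¹ - K_a⁻¹ K_{a+1})` -/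
  EF_rel : ∀ a b, 1 ≤ a → a + 1 ≤ m + n → 1 ≤ b → b + 1 ≤ m + n →
    E a (a+1) * E (b+1) b - sgn m a (a+1) (b+1) b • (E (b+1) b * E a (a+1)) =
      (if a = b then (Δi m a)⁻¹ else 0) • (K a * Kinv (a+1) - Kinv a * K (a+1))
  /-- (iv) simple lowering generators commute when `|a-b| > 1` -/
  EE_lower : ∀ a b, 1 ≤ a → a + 1 ≤ m + n → 1 ≤ b → b + 1 ≤ m + n →
    (a + 1 < b ∨ b + 1 < a) →
    E (a+1) a * E (b+1) b = E (b+1) b * E (a+1) a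
  /-- (iv) simple raising generators commute when `|a-b| > 1` -/
  EE_raise : ∀ a b, 1 ≤ a → a + 1 ≤ m + n → 1 ≤ b → b + 1 ≤ m + n →
    (a + 1 < b ∨ b + 1 < a) →
    E a (a+1) * E b (b+1) = E b (b+1) * E a (a+1)
  /-- (v) the square of the odd simple raising generator is zero -/
  odd_raise_sq : E m (m+1) * E m (m+1) = 0
  /-- (v) the square of the odd simple lowering generator is zero -/
  odd_lower_sq : E (m+1) m * E (m+1) m = 0
  /-- (vi) Serre relation `E^{a+1}_a E^{a+2}_a = q_a E^{a+2}_a E^{a+1}_a`, `a ≠ m` -/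
  serre1 : m ≠ 1 → n ≠ 1 → ∀ a, 1 ≤ a → a + 2 ≤ m + n → a ≠ m →
    E (a+1) a * E (a+2) a = qi m a • (E (a+2) a * E (a+1) a)
  /-- (vi) Serre relation `E^a_{a+1} E^a_{a+2} = q_a E^a_{a+2} E^a_{a+1}`, `a ≠ m` -/
  serre2 : m ≠ 1 → n ≠ 1 → ∀ a, 1 ≤ a → a + 2 ≤ m + n → a ≠ m →
    E a (a+1) * E a (a+2) = qi m a • (E a (a+2) * E a (a+1))
  /-- (vi) Serre relation `E^{a+1}_{a-1} E^{a+1}_a = q_a E^{a+1}_a E^{a+1}_{a-1}`, `a ≠ m` -/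
  serre3 : m ≠ 1 → n ≠ 1 → ∀ a, 2 ≤ a → a + 1 ≤ m + n → a ≠ m →
    E (a+1) (a-1) * E (a+1) a = qi m a • (E (a+1) a * E (a+1) (a-1))
  /-- (vi) Serre relation `E^{a-1}_{a+1} E^a_{a+1} = q_a E^a_{a+1} E^{a-1}_{a+1}`, `a ≠ m` -/
  serre4 : m ≠ 1 → n ≠ 1 → ∀ a, 2 ≤ a → a + 1 ≤ m + n → a ≠ m →
    E (a-1) (a+1) * E a (a+1) = qi m a • (E a (a+1) * E (a-1) (a+1))
  /-- (vi) Serre relation `[E^{m+1}_m, E^{m+2}_{m-1}] = 0` -/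
  serre5 : m ≠ 1 → n ≠ 1 →
    E (m+1) m * E (m+2) (m-1) -
      sgn m (m+1) m (m+2) (m-1) • (E (m+2) (m-1) * E (m+1) m) = 0
  /-- (vi) Serre relation `[E^m_{m+1}, E^{m-1}_{m+2}] = 0` -/
  serre6 : m ≠ 1 → n ≠ 1 →
    E m (m+1) * E (m-1) (m+2) -
      sgn m m (m+1) (m-1) (m+2) • (E (m-1) (m+2) * E m (m+1)) = 0
  /-- the nonsimple generators: for any `c` strictly between `a` and `b`,
  `E^a_b = E^a_c E^c_b - q_c^{sign(a-b)} E^c_b E^a_c` -/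
  nonsimple_def : ∀ a b c, 1 ≤ a → a ≤ m + n → 1 ≤ b → b ≤ m + n →
    ((a < c ∧ c < b) ∨ (b < c ∧ c < a)) →
    E a b = E a c * E c b - (if b < a then qi m c else (qi m c)⁻¹) • (E c b * E a c)

attribute [instance] UqGl.ringA UqGl.algA

namespace UqGl

variable {m n : ℕ}

/-- The graded commutator `[E^a_b, E^c_d] = E^a_b E^c_d - (-1)^{[E^a_b][E^c_d]} E^c_d E^a_b`. -/
def br (U : UqGl m n) (a b c d : ℕ) : U.A :=
  U.E a b * U.E c d - sgn m a b c d • (U.E c d * U.E a b)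

end UqGl

namespace UqAux

/-- Pure algebra behind the inductive step for `[E^a_c, E^c_a]`. -/
theorem step {R A : Type*} [CommRing R] [Ring A] [Algebra R A]
    (u v s t w z : R) (huv : u * v = 1) (hw : w * (u - v) = 1)
    (e f X Y k k' l l' : A)
    (ef : e * f = s • (f * e) + w • (k - k'))
    (XY : X * Y = t • (Y * X) + z • (l - l'))
    (eY : e * Y = Y * e) (Xf : X * f = f * X)
    (kX : k * X = v • (X * k)) (kY : k * Y = u • (Y * k))
    (kX' : k' * X = u • (X * k')) (kY' : k' * Y = v • (Y * k'))
    (le : l * e = v • (e * l)) (lf : l * f = u • (f * l))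
    (le' : l' * e = u • (e * l')) (lf' : l' * f = v • (f * l'))
    (kl : k * l = l * k) (kl' : k * l' = l' * k)
    (k'l : k' * l = l * k') (k'l' : k' * l' = l' * k') :
    (X * e - v • (e * X)) * (f * Y - u • (Y * f)) -
      (s * t) • ((f * Y - u • (Y * f)) * (X * e - v • (e * X)))
      = z • (l * k - l' * k') := by
  have ef2 : ∀ r, e * (f * r) = s • (f * (e * r)) + w • (k * r - k' * r) := fun r => by
    rw [← mul_assoc, ef]; simp only [add_mul, sub_mul, smul_mul_assoc, mul_assoc]
  have XY2 : ∀ r, X * (Y * r) = t • (Y * (X * r)) + z • (l * r - l' * r) := fun r => by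
    rw [← mul_assoc, XY]; simp only [add_mul, sub_mul, smul_mul_assoc, mul_assoc]
  have eY2 : ∀ r, e * (Y * r) = Y * (e * r) := fun r => by
    rw [← mul_assoc, eY, mul_assoc]
  have Xf2 : ∀ r, X * (f * r) = f * (X * r) := fun r => by
    rw [← mul_assoc, Xf, mul_assoc]
  have g : ∀ {c : R} {x y : A}, x * y = c • (y * x) → ∀ r, x * (y * r) = c • (y * (x * r)) := by
    intro c x y h r
    rw [← mul_assoc, h, smul_mul_assoc, mul_assoc]
  have kX2 := g kX
  have kY2 := g kY
  have kX2' := g kX'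
  have kY2' := g kY'
  have le2 := g le
  have lf2 := g lf
  have le2' := g le'
  have lf2' := g lf'
  simp only [mul_sub, sub_mul, mul_add, add_mul, smul_mul_assoc, mul_smul_comm, mul_assoc,
    smul_add, smul_sub, ef, XY, eY, Xf, ef2, XY2, eY2, Xf2, kX, kY, kX', kY', le, lf, le', lf',
    kX2, kY2, kX2', kY2', le2, lf2, le2', lf2', kl, kl', k'l, k'l']
  match_scalars <;> grind

/-- Pure algebra of the final step. -/
theorem final {R A : Type*} [CommRing R] [Ring A] [Algebra R A]
    (u v s z : R) (hz : z * (u - v) = 1)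
    (X Y Z l l' : A)
    (XY : X * Y = s • (Y * X) + z • (l - l'))
    (XZ : X * Z = Z * X)
    (lZ : l * Z = u • (Z * l)) (lZ' : l' * Z = v • (Z * l')) :
    X * (Y * Z - u • (Z * Y)) - s • ((Y * Z - u • (Z * Y)) * X) = Z * l' := by
  have XY2 : ∀ r, X * (Y * r) = s • (Y * (X * r)) + z • (l * r - l' * r) := fun r => by
    rw [← mul_assoc, XY]; simp only [add_mul, sub_mul, smul_mul_assoc, mul_assoc]
  have XZ2 : ∀ r, X * (Z * r) = Z * (X * r) := fun r => by
    rw [← mul_assoc, XZ, mul_assoc]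
  simp only [mul_sub, sub_mul, mul_add, add_mul, smul_mul_assoc, mul_smul_comm, mul_assoc,
    smul_add, smul_sub, XY, XY2, XZ, XZ2, lZ, lZ']
  match_scalars <;> grind

theorem qq_ne : qq ≠ 0 := RatFunc.X_ne_zero

theorem qi_ne (m a : ℕ) : qi m a ≠ 0 := by
  unfold qi; split_ifs
  · exact qq_ne
  · exact inv_ne_zero qq_ne

theorem Δq_ne : Δq ≠ 0 := by
  unfold Δq
  intro h
  have h1 : qq * qq = 1 := by
    have := qq_ne
    field_simp at h
    linear_combination h
  have h2 : (algebraMap (Polynomial ℚ) (RatFunc ℚ)) (Polynomial.X * Polynomial.X)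
      = algebraMap (Polynomial ℚ) (RatFunc ℚ) 1 := by
    rw [map_mul, RatFunc.algebraMap_X, map_one]; exact h1
  have h3 := RatFunc.algebraMap_injective ℚ h2
  have h4 := congrArg (Polynomial.eval 0) h3
  simp at h4

theorem Δi_eq (m a : ℕ) : Δi m a = qi m a - (qi m a)⁻¹ := by
  unfold Δi qi gr Δq; split_ifs <;> simp

theorem Δi_ne (m a : ℕ) : Δi m a ≠ 0 := by
  unfold Δi
  exact mul_ne_zero (pow_ne_zero _ (by norm_num)) Δq_ne

theorem Δi_inv (m a : ℕ) : (Δi m a)⁻¹ * (qi m a - (qi m a)⁻¹) = 1 := by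
  rw [← Δi_eq]; exact inv_mul_cancel₀ (Δi_ne m a)

variable {m n : ℕ} (U : UqGl m n)

/-- weights multiply -/
theorem wt_mul {A : Type*} [Ring A] [Algebra Fq A] {k x y : A} {c d : Fq}
    (hx : k * x = c • (x * k)) (hy : k * y = d • (y * k)) :
    k * (x * y) = (c * d) • ((x * y) * k) := by
  rw [← mul_assoc, hx, smul_mul_assoc, mul_assoc, hy, mul_smul_comm, smul_smul, mul_assoc]

theorem wt_inv {A : Type*} [Ring A] [Algebra Fq A] {k k' x : A} {c : Fq} (hc : c ≠ 0)
    (h1 : k * k' = 1) (h2 : k' * k = 1)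
    (hx : k * x = c • (x * k)) : k' * x = c⁻¹ • (x * k') := by
  have h : x * k' = c • (k' * x) := by
    calc x * k' = k' * (k * x) * k' := by rw [← mul_assoc, h2, one_mul]
      _ = c • (k' * x) := by
        rw [hx, mul_smul_comm, smul_mul_assoc, mul_assoc, mul_assoc, h1, mul_one]
  rw [h, smul_smul, inv_mul_cancel₀ hc, one_smul]

theorem raise_def (a d c : ℕ) (h1 : 1 ≤ a) (had : a < d) (hdc : d < c) (hc : c ≤ m + n) :
    U.E a c = U.E a d * U.E d c - (qi m d)⁻¹ • (U.E d c * U.E a d) := by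
  have := U.nonsimple_def a c d h1 (by omega) (by omega) hc (Or.inl ⟨had, hdc⟩)
  rwa [if_neg (by omega)] at this

theorem lower_def (a d c : ℕ) (h1 : 1 ≤ a) (had : a < d) (hdc : d < c) (hc : c ≤ m + n) :
    U.E c a = U.E c d * U.E d a - qi m d • (U.E d a * U.E c d) := by
  have := U.nonsimple_def c a d (by omega) hc h1 (by omega) (Or.inr ⟨had, hdc⟩)
  rwa [if_pos (by omega)] at this

theorem wt_raise (i a c : ℕ) (hi : 1 ≤ i) (hi' : i ≤ m + n) (h1 : 1 ≤ a) (hac : a < c)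
    (hc : c ≤ m + n) :
    U.K i * U.E a c = (qi m i ^ (δℤ i a - δℤ i c)) • (U.E a c * U.K i) := by
  induction c, hac using Nat.le_induction with
  | base => exact U.K_E_raise i a hi hi' h1 hc
  | succ c hac ih =>
    have ih := ih (by omega)
    have hs := U.K_E_raise i c hi hi' (by omega) hc
    have h1' := wt_mul ih hs
    have h2' := wt_mul hs ih
    rw [← zpow_add₀ (qi_ne m i)] at h1' h2'
    rw [show δℤ i a - δℤ i c + (δℤ i c - δℤ i (c+1)) = δℤ i a - δℤ i (c+1) by ring] at h1'
    rw [show δℤ i c - δℤ i (c+1) + (δℤ i a - δℤ i c) = δℤ i a - δℤ i (c+1) by ring] at h2'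
    rw [raise_def U a c (c+1) h1 hac (by omega) hc, mul_sub, mul_smul_comm, h1', h2', sub_mul,
      smul_mul_assoc, smul_sub, smul_comm]

theorem wt_lower (i a c : ℕ) (hi : 1 ≤ i) (hi' : i ≤ m + n) (h1 : 1 ≤ a) (hac : a < c)
    (hc : c ≤ m + n) :
    U.K i * U.E c a = (qi m i ^ (δℤ i c - δℤ i a)) • (U.E c a * U.K i) := by
  induction c, hac using Nat.le_induction with
  | base => exact U.K_E_lower i a hi hi' h1 hc
  | succ c hac ih =>
    have ih := ih (by omega)
    have hs := U.K_E_lower i c hi hi' (by omega) hc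
    have h1' := wt_mul ih hs
    have h2' := wt_mul hs ih
    rw [← zpow_add₀ (qi_ne m i)] at h1' h2'
    rw [show δℤ i c - δℤ i a + (δℤ i (c+1) - δℤ i c) = δℤ i (c+1) - δℤ i a by ring] at h1'
    rw [show δℤ i (c+1) - δℤ i c + (δℤ i c - δℤ i a) = δℤ i (c+1) - δℤ i a by ring] at h2'
    rw [lower_def U a c (c+1) h1 hac (by omega) hc, mul_sub, mul_smul_comm, h1', h2', sub_mul,
      smul_mul_assoc, smul_sub, smul_comm]

theorem comm_lower (x : U.A) (a c : ℕ) (h1 : 1 ≤ a) (hac : a < c) (hc : c ≤ m + n)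
    (h : ∀ j, a ≤ j → j < c → Commute x (U.E (j+1) j)) : Commute x (U.E c a) := by
  induction c, hac using Nat.le_induction with
  | base => exact h a le_rfl (by omega)
  | succ c hac ih =>
    have ih := ih (by omega) (fun j h1 h2 => h j h1 (by omega))
    have hs := h c (by omega) (by omega)
    rw [lower_def U a c (c+1) h1 hac (by omega) hc]
    exact (hs.mul_right ih).sub_right ((ih.mul_right hs).smul_right _)

theorem comm_raise (x : U.A) (a c : ℕ) (h1 : 1 ≤ a) (hac : a < c) (hc : c ≤ m + n)
    (h : ∀ j, a ≤ j → j < c → Commute x (U.E j (j+1))) : Commute x (U.E a c) := by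
  induction c, hac using Nat.le_induction with
  | base => exact h a le_rfl (by omega)
  | succ c hac ih =>
    have ih := ih (by omega) (fun j h1 h2 => h j h1 (by omega))
    have hs := h c (by omega) (by omega)
    rw [raise_def U a c (c+1) h1 hac (by omega) hc]
    exact (ih.mul_right hs).sub_right ((hs.mul_right ih).smul_right _)

theorem comm_simple (i j : ℕ) (hi : 1 ≤ i) (hi' : i + 1 ≤ m + n) (hj : 1 ≤ j)
    (hj' : j + 1 ≤ m + n) (hij : i ≠ j) : Commute (U.E i (i+1)) (U.E (j+1) j) := by
  have h := U.EF_rel i j hi hi' hj hj'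
  have hs : sgn m i (i+1) (j+1) j = 1 := by
    unfold sgn gr
    split_ifs <;> first | omega | norm_num
  rw [if_neg hij, zero_smul, hs, one_smul] at h
  exact sub_eq_zero.mp h

theorem comm_disj (a c b d : ℕ) (ha : 1 ≤ a) (hac : a < c) (hc : c ≤ m + n)
    (hb : 1 ≤ b) (hbd : b < d) (hd : d ≤ m + n) (h : c ≤ b ∨ d ≤ a) :
    U.E a c * U.E d b = U.E d b * U.E a c := by
  have : Commute (U.E a c) (U.E d b) := by
    apply comm_lower U _ b d hb hbd hd
    intro j hj1 hj2
    apply Commute.symm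
    apply comm_raise U _ a c ha hac hc
    intro i hi1 hi2
    exact (comm_simple U i j (by omega) (by omega) (by omega) (by omega) (by omega)).symm
  exact this

theorem K_Kinv_comm (a b : ℕ) (h1 : 1 ≤ a) (h2 : a ≤ m + n) (h3 : 1 ≤ b) (h4 : b ≤ m + n) :
    Commute (U.K a) (U.Kinv b) := by
  have h := wt_inv (c := 1) one_ne_zero (U.K_Kinv b h3 h4) (U.Kinv_K b h3 h4)
    (x := U.K a) (by rw [one_smul]; exact U.K_comm b a h3 h4 h1 h2)
  rw [inv_one, one_smul] at h
  exact h.symm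

theorem Kinv_Kinv_comm (a b : ℕ) (h1 : 1 ≤ a) (h2 : a ≤ m + n) (h3 : 1 ≤ b) (h4 : b ≤ m + n) :
    Commute (U.Kinv a) (U.Kinv b) := by
  have h := wt_inv (c := 1) one_ne_zero (U.K_Kinv b h3 h4) (U.Kinv_K b h3 h4)
    (x := U.Kinv a) (by rw [one_smul]; exact (K_Kinv_comm U b a h3 h4 h1 h2))
  rw [inv_one, one_smul] at h
  exact h.symm

/-- `k x = c x k`, `l x = d x l` imply `(k l) x = (d c) x (k l)`. -/
theorem wt_mul' {A : Type*} [Ring A] [Algebra Fq A] {k l x : A} {c d e : Fq}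
    (hx : k * x = c • (x * k)) (hy : l * x = d • (x * l)) (he : c * d = e) :
    (k * l) * x = e • (x * (k * l)) := by
  rw [mul_assoc, hy, mul_smul_comm, ← mul_assoc, hx, smul_mul_assoc, smul_smul, mul_assoc,
    mul_comm d, he]

theorem wtinv_raise (i a c : ℕ) (hi : 1 ≤ i) (hi' : i ≤ m + n) (h1 : 1 ≤ a) (hac : a < c)
    (hc : c ≤ m + n) :
    U.Kinv i * U.E a c = (qi m i ^ (δℤ i a - δℤ i c))⁻¹ • (U.E a c * U.Kinv i) :=
  wt_inv (zpow_ne_zero _ (qi_ne m i)) (U.K_Kinv i hi hi') (U.Kinv_K i hi hi')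
    (wt_raise U i a c hi hi' h1 hac hc)

theorem wtinv_lower (i a c : ℕ) (hi : 1 ≤ i) (hi' : i ≤ m + n) (h1 : 1 ≤ a) (hac : a < c)
    (hc : c ≤ m + n) :
    U.Kinv i * U.E c a = (qi m i ^ (δℤ i c - δℤ i a))⁻¹ • (U.E c a * U.Kinv i) :=
  wt_inv (zpow_ne_zero _ (qi_ne m i)) (U.K_Kinv i hi hi') (U.Kinv_K i hi hi')
    (wt_lower U i a c hi hi' h1 hac hc)

theorem sgn_mul (a d c : ℕ) (had : a < d) (hdc : d < c) :
    sgn m a c c a = sgn m d c c d * sgn m a d d a := by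
  unfold sgn gr
  split_ifs <;> first | omega | norm_num

theorem Δi_inv' (m a : ℕ) : (Δi m a)⁻¹ * (qi m a - (qi m a)⁻¹) = 1 := Δi_inv m a

theorem EF_gen (a c : ℕ) (h1 : 1 ≤ a) (hac : a < c) (hc : c ≤ m + n) :
    U.E a c * U.E c a = sgn m a c c a • (U.E c a * U.E a c) +
      (Δi m a)⁻¹ • (U.K a * U.Kinv c - U.Kinv a * U.K c) := by
  induction c, hac using Nat.le_induction with
  | base =>
    have h := U.EF_rel a a h1 hc h1 hc
    rw [if_pos rfl] at h
    rw [← h]; abel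
  | succ d had ih =>
    have ih := ih (by omega)
    have had' : a < d := had
    have hd1 : 1 ≤ d := by omega
    have hd2 : d ≤ m + n := by omega
    have ha2 : a ≤ m + n := by omega
    have hc1 : 1 ≤ d + 1 := by omega
    have hs := U.EF_rel d d (by omega) hc (by omega) hc
    rw [if_pos rfl, sub_eq_iff_eq_add'] at hs
    rw [raise_def U a d (d+1) h1 had (by omega) hc, lower_def U a d (d+1) h1 had (by omega) hc,
      sgn_mul a d (d+1) had (by omega), ← sub_eq_iff_eq_add']
    have c1 := K_Kinv_comm U
    have c2 := Kinv_Kinv_comm U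
    have c3 : ∀ a b, 1 ≤ a → a ≤ m + n → 1 ≤ b → b ≤ m + n → Commute (U.K a) (U.K b) :=
      U.K_comm
    have c4 : ∀ a b, 1 ≤ a → a ≤ m + n → 1 ≤ b → b ≤ m + n → Commute (U.Kinv a) (U.K b) :=
      fun a b h1 h2 h3 h4 => (c1 b a h3 h4 h1 h2).symm
    have key := step (qi m d) (qi m d)⁻¹ (sgn m d (d+1) (d+1) d) (sgn m a d d a) (Δi m d)⁻¹
      (Δi m a)⁻¹ (mul_inv_cancel₀ (qi_ne m d)) (Δi_inv m d)
      (U.E d (d+1)) (U.E (d+1) d) (U.E a d) (U.E d a)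
      (U.K d * U.Kinv (d+1)) (U.Kinv d * U.K (d+1)) (U.K a * U.Kinv d) (U.Kinv a * U.K d)
      hs ih
      (comm_disj U d (d+1) a d (by omega) (by omega) hc h1 had' hd2 (by omega))
      (comm_disj U a d d (d+1) h1 had' hd2 hd1 (by omega) hc (by omega))
      (wt_mul' (wt_raise U _ _ _ hd1 hd2 h1 had' hd2) (wtinv_raise U _ _ _ hc1 hc h1 had' hd2)
        (by simp [δℤ, show d ≠ a by omega, show d + 1 ≠ a by omega]))
      (wt_mul' (wt_lower U _ _ _ hd1 hd2 h1 had' hd2) (wtinv_lower U _ _ _ hc1 hc h1 had' hd2)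
        (by simp [δℤ, show d ≠ a by omega, show d + 1 ≠ a by omega]))
      (wt_mul' (wtinv_raise U _ _ _ hd1 hd2 h1 had' hd2) (wt_raise U _ _ _ hc1 hc h1 had' hd2)
        (by simp [δℤ, show d ≠ a by omega, show d + 1 ≠ a by omega]))
      (wt_mul' (wtinv_lower U _ _ _ hd1 hd2 h1 had' hd2) (wt_lower U _ _ _ hc1 hc h1 had' hd2)
        (by simp [δℤ, show d ≠ a by omega, show d + 1 ≠ a by omega]))
      (wt_mul' (wt_raise U _ _ _ h1 ha2 hd1 (Nat.lt_succ_self d) hc)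
        (wtinv_raise U _ _ _ hd1 hd2 hd1 (Nat.lt_succ_self d) hc)
        (by simp [δℤ, show a ≠ d by omega, show a ≠ d + 1 by omega]))
      (wt_mul' (wt_lower U _ _ _ h1 ha2 hd1 (Nat.lt_succ_self d) hc)
        (wtinv_lower U _ _ _ hd1 hd2 hd1 (Nat.lt_succ_self d) hc)
        (by simp [δℤ, show a ≠ d by omega, show a ≠ d + 1 by omega]))
      (wt_mul' (wtinv_raise U _ _ _ h1 ha2 hd1 (Nat.lt_succ_self d) hc)
        (wt_raise U _ _ _ hd1 hd2 hd1 (Nat.lt_succ_self d) hc)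
        (by simp [δℤ, show a ≠ d by omega, show a ≠ d + 1 by omega]))
      (wt_mul' (wtinv_lower U _ _ _ h1 ha2 hd1 (Nat.lt_succ_self d) hc)
        (wt_lower U _ _ _ hd1 hd2 hd1 (Nat.lt_succ_self d) hc)
        (by simp [δℤ, show a ≠ d by omega, show a ≠ d + 1 by omega]))
      (Commute.mul_left (Commute.mul_right (by apply c3 <;> assumption) (by apply c1 <;> assumption))
        (Commute.mul_right (by apply c4 <;> assumption) (by apply c2 <;> assumption)))
      (Commute.mul_left (Commute.mul_right (by apply c1 <;> assumption) (by apply c3 <;> assumption))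
        (Commute.mul_right (by apply c2 <;> assumption) (by apply c4 <;> assumption)))
      (Commute.mul_left (Commute.mul_right (by apply c4 <;> assumption) (by apply c2 <;> assumption))
        (Commute.mul_right (by apply c3 <;> assumption) (by apply c1 <;> assumption)))
      (Commute.mul_left (Commute.mul_right (by apply c2 <;> assumption) (by apply c4 <;> assumption))
        (Commute.mul_right (by apply c1 <;> assumption) (by apply c3 <;> assumption)))
    have e1 : U.K a * U.Kinv d * (U.K d * U.Kinv (d+1)) = U.K a * U.Kinv (d+1) := by
      rw [mul_assoc, ← mul_assoc (U.Kinv d), U.Kinv_K d hd1 hd2, one_mul]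
    have e2 : U.Kinv a * U.K d * (U.Kinv d * U.K (d+1)) = U.Kinv a * U.K (d+1) := by
      rw [mul_assoc, ← mul_assoc (U.K d), U.K_Kinv d hd1 hd2, one_mul]
    rw [e1, e2] at key
    exact key

end UqAux

theorem stmt3 (m n : ℕ) (hm : 1 ≤ m) (hn : 1 ≤ n) (U : UqGl m n)
    (a b c : ℕ)
    (h1 : 1 ≤ a) (h2 : a ≤ m + n) (h3 : 1 ≤ b) (h4 : b ≤ m + n)
    (h5 : 1 ≤ c) (h6 : c ≤ m + n)
    (hba : b < a) (hac : a < c) :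
    U.br a c c b = U.E a b * U.Kinv a * U.K c := by
  have ha2 := h2
  have hs : sgn m a c c b = sgn m a c c a := by
    unfold sgn gr
    split_ifs <;> first | omega | norm_num
  unfold UqGl.br
  rw [hs, UqAux.lower_def U b a c h3 hba hac h6, mul_assoc]
  exact UqAux.final (qi m a) (qi m a)⁻¹ (sgn m a c c a) (Δi m a)⁻¹ (UqAux.Δi_inv m a)
    (U.E a c) (U.E c a) (U.E a b) (U.K a * U.Kinv c) (U.Kinv a * U.K c)
    (UqAux.EF_gen U a c h1 hac h6)
    (UqAux.comm_disj U a c b a h1 hac h6 h3 hba h2 (by omega))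
    (UqAux.wt_mul' (UqAux.wt_lower U _ _ _ h1 h2 h3 hba h2)
      (UqAux.wtinv_lower U _ _ _ h5 h6 h3 hba h2)
      (by simp [δℤ, show a ≠ b by omega, show c ≠ a by omega, show c ≠ b by omega]))
    (UqAux.wt_mul' (UqAux.wtinv_lower U _ _ _ h1 h2 h3 hba h2)
      (UqAux.wt_lower U _ _ _ h5 h6 h3 hba h2)
      (by simp [δℤ, show a ≠ b by omega, show c ≠ a by omega, show c ≠ b by omega]))

end
end

section
/- In U_q[gl(m|n)], for indices with a < b < c, the graded commutator satisfies [E^a_c, E^c_b] = K_b K_c^{-1} E^a_b. -/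
/-!
U_q[gl(m|n)]: the quantum superalgebra presented by generators and relations,
following Zhang (1993).  We work over the field ℚ(q) of rational functions.
-/

noncomputable section

section Abstract
variable {Fq : Type} [Field Fq] {A : Type} [Ring A] [Algebra Fq A]

theorem abs_comm (x y F : A) (r s : Fq) (Z : A) (h1 : x * F = F * x)
    (h2 : y * F - s • (F * y) = Z) :
    (x * y - r • (y * x)) * F - s • (F * (x * y - r • (y * x))) = x * Z - r • (Z * x) := by
  subst h2
  simp only [mul_sub, sub_mul, smul_mul_assoc, mul_smul_comm, mul_assoc, smul_sub, h1]
  rw [← mul_assoc x F y, h1, mul_assoc]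
  rw [smul_comm s r]
  abel

theorem abs_comm2 (x y F : A) (r s : Fq) (Z : A) (h1 : y * F = F * y)
    (h2 : x * F - s • (F * x) = Z) :
    (x * y - r • (y * x)) * F - s • (F * (x * y - r • (y * x))) = Z * y - r • (y * Z) := by
  subst h2
  simp only [mul_sub, sub_mul, smul_mul_assoc, mul_smul_comm, mul_assoc, smul_sub, h1]
  rw [← mul_assoc y F x, h1, mul_assoc]
  rw [smul_comm s r]
  abel

theorem abs_H (E f y x e kc bk H1 H2 : A) (p s t w : Fq) (hp : p ≠ 0)
    (hf : E * f - s • (f * E) = kc * x)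
    (hy : E * y - t • (y * E) = w • (bk * e))
    (hk : y * kc = p⁻¹ • (kc * y)) (hb : f * bk = p • (bk * f))
    (h1 : x * y - t • (y * x) = H1) (h2 : e * f - s • (f * e) = H2) :
    E * (f * y - p • (y * f)) - (s * t) • ((f * y - p • (y * f)) * E)
      = kc * H1 - (p * w) • (bk * H2) := by
  have hf' : E * f = kc * x + s • (f * E) := by rw [← hf]; abel
  have hy' : E * y = w • (bk * e) + t • (y * E) := by rw [← hy]; abel
  have e1 : E * (f * y) = kc * (x * y) + (s * w * p) • (bk * (f * e)) + (s * t) • (f * (y * E)) := by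
    rw [← mul_assoc, hf', add_mul, smul_mul_assoc, mul_assoc f, hy', mul_add, mul_smul_comm,
      ← mul_assoc f bk, hb, mul_smul_comm, smul_mul_assoc]
    simp only [smul_add, smul_smul, mul_assoc, add_assoc]
  have e2 : E * (y * f) = w • (bk * (e * f)) + (t * p⁻¹) • (kc * (y * x))
      + (s * t) • (y * (f * E)) := by
    rw [← mul_assoc, hy', add_mul, smul_mul_assoc, smul_mul_assoc, mul_assoc y, hf', mul_add,
      mul_smul_comm, ← mul_assoc y kc, hk, smul_mul_assoc]
    simp only [smul_add, smul_smul, mul_assoc, add_assoc, mul_comm s t]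
  rw [mul_sub, mul_smul_comm, e1, e2, ← h1, ← h2]
  simp only [sub_mul, mul_sub, smul_mul_assoc, mul_smul_comm, mul_assoc]
  have : p * (t * p⁻¹) = t := by field_simp
  simp only [smul_add, smul_sub, smul_smul, this]
  module

theorem sc1 (p : Fq) (X Y : A) (hp : p ≠ 0) (hD : p - p⁻¹ ≠ 0) :
    (p - p⁻¹)⁻¹ • X - (p - p⁻¹)⁻¹ • Y -
      ((p⁻¹ * (p - p⁻¹)⁻¹ * p⁻¹) • X - (p⁻¹ * (p - p⁻¹)⁻¹ * p) • Y) = p⁻¹ • X := by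
  obtain ⟨D, hDd⟩ : ∃ D, D = p - p⁻¹ := ⟨_, rfl⟩
  rw [← hDd] at hD ⊢
  have h : p * D = p ^ 2 - 1 := by rw [hDd]; field_simp
  match_scalars
  · field_simp
    linear_combination -h
  · field_simp
    ring

theorem sc2 (p D : Fq) (X Y : A) (hp : p ≠ 0) :
    (D⁻¹ * p⁻¹) • X - (D⁻¹ * p) • Y - ((p⁻¹ * D⁻¹) • X - (p⁻¹ * D⁻¹) • Y) =
      -(D⁻¹ * (p - p⁻¹) * p⁻¹) • p • Y := by
  match_scalars
  · ring
  · field_simp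
    ring

theorem sc3 (p D D2 : Fq) (X Y Z : A) (hp : p ≠ 0) (hD2 : D2 ≠ 0) :
    D⁻¹ • (X - Y) - (p * -(D⁻¹ * D2 * p⁻¹)) • D2⁻¹ • (Y - Z) = D⁻¹ • (X - Z) := by
  have : p * -(D⁻¹ * D2 * p⁻¹) * D2⁻¹ = - D⁻¹ := by field_simp
  rw [smul_smul, this]
  module

end Abstract

namespace UqGl
variable {m n : ℕ}

theorem qi_ne (m a : ℕ) : qi m a ≠ 0 := by
  have : qq ≠ 0 := RatFunc.X_ne_zero
  unfold qi; split_ifs <;> simp [this]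

theorem Δi_eq (m a : ℕ) : Δi m a = qi m a - (qi m a)⁻¹ := by
  unfold Δi qi gr Δq; split_ifs <;> simp

theorem Δi_ne (m a : ℕ) : Δi m a ≠ 0 := by
  have h0 : qq ≠ 0 := RatFunc.X_ne_zero
  have : Δq ≠ 0 := by
    unfold Δq
    intro h
    have h2 : qq ^ 2 = 1 := by
      field_simp at h
      linear_combination h
    have h3 : (algebraMap (Polynomial ℚ) Fq) (Polynomial.X ^ 2) = algebraMap (Polynomial ℚ) Fq 1 := by
      rw [map_pow, RatFunc.algebraMap_X, map_one]; exact h2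
    have h4 := RatFunc.algebraMap_injective ℚ h3
    have h5 := congrArg Polynomial.natDegree h4
    simp at h5
  unfold Δi
  exact mul_ne_zero (pow_ne_zero _ (by simp)) this

theorem def_up (U : UqGl m n) (a b c : ℕ) (ha : 1 ≤ a) (hac : a < c) (hcb : c < b)
    (hb : b ≤ m + n) :
    U.E a b = U.E a c * U.E c b - (qi m c)⁻¹ • (U.E c b * U.E a c) := by
  have := U.nonsimple_def a b c ha (by omega) (by omega) hb (Or.inl ⟨hac, hcb⟩)
  rwa [if_neg (by omega)] at this

theorem def_down (U : UqGl m n) (a b c : ℕ) (ha : 1 ≤ a) (hac : a < c) (hcb : c < b)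
    (hb : b ≤ m + n) :
    U.E b a = U.E b c * U.E c a - qi m c • (U.E c a * U.E b c) := by
  have := U.nonsimple_def b a c (by omega) hb ha (by omega) (Or.inr ⟨hac, hcb⟩)
  rwa [if_pos (by omega)] at this

theorem wt_mul {A : Type} [Ring A] [Algebra Fq A] (k x y : A) (u v r : Fq)
    (hx : k * x = u • (x * k)) (hy : k * y = v • (y * k)) :
    k * (x * y - r • (y * x)) = (u * v) • ((x * y - r • (y * x)) * k) := by
  have e1 : k * (x * y) = (u * v) • (x * y * k) := by
    rw [← mul_assoc, hx, smul_mul_assoc, mul_assoc, hy, mul_smul_comm, smul_smul, mul_assoc]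
  have e2 : k * (y * x) = (u * v) • (y * x * k) := by
    rw [← mul_assoc, hy, smul_mul_assoc, mul_assoc, hx, mul_smul_comm, smul_smul, mul_assoc,
      mul_comm u v]
  rw [mul_sub, mul_smul_comm, e1, e2, sub_mul, smul_sub, smul_mul_assoc, smul_comm r]

theorem wt_up (U : UqGl m n) (i a b : ℕ) (hi : 1 ≤ i) (hi' : i ≤ m + n) (ha : 1 ≤ a)
    (hab : a < b) (hb : b ≤ m + n) :
    U.K i * U.E a b = (qi m i ^ (δℤ i a - δℤ i b)) • (U.E a b * U.K i) := by
  induction b, hab using Nat.le_induction with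
  | base => exact U.K_E_raise i a hi hi' ha hb
  | succ d hd ih =>
    rw [U.def_up a (d+1) d ha hd (by omega) hb,
      wt_mul _ _ _ _ _ _ (ih (by omega)) (U.K_E_raise i d hi hi' (by omega) hb),
      ← zpow_add₀ (qi_ne m i)]
    congr 2; ring

theorem wt_down (U : UqGl m n) (i a b : ℕ) (hi : 1 ≤ i) (hi' : i ≤ m + n) (ha : 1 ≤ a)
    (hab : a < b) (hb : b ≤ m + n) :
    U.K i * U.E b a = (qi m i ^ (δℤ i b - δℤ i a)) • (U.E b a * U.K i) := by
  induction b, hab using Nat.le_induction with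
  | base => exact U.K_E_lower i a hi hi' ha hb
  | succ d hd ih =>
    rw [U.def_down a (d+1) d ha hd (by omega) hb,
      wt_mul _ _ _ _ _ _ (U.K_E_lower i d hi hi' (by omega) hb) (ih (by omega)),
      ← zpow_add₀ (qi_ne m i)]
    congr 2; ring

/-- `K x = u x K` gives `K⁻¹ x = u⁻¹ x K⁻¹`. -/
theorem wt_inv {A : Type} [Ring A] [Algebra Fq A] (k k' x : A) (u : Fq) (hu : u ≠ 0)
    (h1 : k * k' = 1) (h2 : k' * k = 1) (h : k * x = u • (x * k)) :
    k' * x = u⁻¹ • (x * k') := by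
  have : x * k' = u • (k' * x) := by
    calc x * k' = k' * (k * x) * k' := by rw [← mul_assoc, h2, one_mul]
      _ = u • (k' * x) := by rw [h, mul_smul_comm, smul_mul_assoc, mul_assoc, mul_assoc, h1, mul_one]
  rw [this, smul_smul, inv_mul_cancel₀ hu, one_smul]

theorem wti_up (U : UqGl m n) (i a b : ℕ) (hi : 1 ≤ i) (hi' : i ≤ m + n) (ha : 1 ≤ a)
    (hab : a < b) (hb : b ≤ m + n) :
    U.Kinv i * U.E a b = (qi m i ^ (δℤ i a - δℤ i b))⁻¹ • (U.E a b * U.Kinv i) :=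
  wt_inv _ _ _ _ (zpow_ne_zero _ (qi_ne m i)) (U.K_Kinv i hi hi') (U.Kinv_K i hi hi')
    (U.wt_up i a b hi hi' ha hab hb)

theorem wti_down (U : UqGl m n) (i a b : ℕ) (hi : 1 ≤ i) (hi' : i ≤ m + n) (ha : 1 ≤ a)
    (hab : a < b) (hb : b ≤ m + n) :
    U.Kinv i * U.E b a = (qi m i ^ (δℤ i b - δℤ i a))⁻¹ • (U.E b a * U.Kinv i) :=
  wt_inv _ _ _ _ (zpow_ne_zero _ (qi_ne m i)) (U.K_Kinv i hi hi') (U.Kinv_K i hi hi')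
    (U.wt_down i a b hi hi' ha hab hb)

theorem comm_comb {A : Type} [Ring A] [Algebra Fq A] {x y z : A} (r : Fq) (hx : Commute x z)
    (hy : Commute y z) : Commute (x * y - r • (y * x)) z :=
  (hx.mul_left hy).sub_left ((hy.mul_left hx).smul_left r)

theorem comm_simple (U : UqGl m n) (i j : ℕ) (hi : 1 ≤ i) (hi' : i + 1 ≤ m + n)
    (hj : 1 ≤ j) (hj' : j + 1 ≤ m + n) (hij : i ≠ j) :
    Commute (U.E i (i+1)) (U.E (j+1) j) := by
  have h := U.EF_rel i j hi hi' hj hj'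
  have hs : sgn m i (i+1) (j+1) j = 1 := by
    unfold sgn gr; split_ifs <;> first | omega | norm_num
  rw [if_neg hij, zero_smul, hs, one_smul] at h
  exact sub_eq_zero.mp h

theorem comm_s (U : UqGl m n) (i c d : ℕ) (hi : 1 ≤ i) (hi' : i + 1 ≤ m + n)
    (hc : 1 ≤ c) (hcd : c < d) (hd : d ≤ m + n) (h : i + 1 ≤ c ∨ d ≤ i) :
    Commute (U.E i (i+1)) (U.E d c) := by
  induction d, hcd using Nat.le_induction with
  | base => exact U.comm_simple i c hi hi' hc hd (by omega)
  | succ d hd' ih =>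
    rw [U.def_down c (d+1) d hc hd' (by omega) hd]
    exact (comm_comb _ (U.comm_simple i d hi hi' (by omega) hd (by omega)).symm
      (ih (by omega) (by omega)).symm).symm

theorem comm_gen (U : UqGl m n) (a b c d : ℕ) (ha : 1 ≤ a) (hab : a < b) (hb : b ≤ m + n)
    (hc : 1 ≤ c) (hcd : c < d) (hd : d ≤ m + n) (h : b ≤ c ∨ d ≤ a) :
    Commute (U.E a b) (U.E d c) := by
  induction b, hab using Nat.le_induction with
  | base => exact U.comm_s a c d ha hb hc hcd hd h
  | succ e he ih =>
    rw [U.def_up a (e+1) e ha he (by omega) hb]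
    exact comm_comb _ (ih (by omega) (by omega)) (U.comm_s e c d (by omega) hb hc hcd hd (by omega))

/-- The Cartan element on the right-hand side of `[E^b_c, E^c_b]`. -/
def H (U : UqGl m n) (b c : ℕ) : U.A :=
  (Δi m b)⁻¹ • (U.K b * U.Kinv c - U.Kinv b * U.K c)

theorem K_Kinv_comm (U : UqGl m n) (a b : ℕ) (ha : 1 ≤ a) (ha' : a ≤ m + n) (hb : 1 ≤ b)
    (hb' : b ≤ m + n) : U.K a * U.Kinv b = U.Kinv b * U.K a := by
  have := wt_inv (U.K b) (U.Kinv b) (U.K a) 1 one_ne_zero (U.K_Kinv b hb hb') (U.Kinv_K b hb hb')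
    (by rw [one_smul]; exact U.K_comm b a hb hb' ha ha')
  simpa using this.symm

theorem Kinv_comm (U : UqGl m n) (a b : ℕ) (ha : 1 ≤ a) (ha' : a ≤ m + n) (hb : 1 ≤ b)
    (hb' : b ≤ m + n) : U.Kinv a * U.Kinv b = U.Kinv b * U.Kinv a := by
  have := wt_inv (U.K b) (U.Kinv b) (U.Kinv a) 1 one_ne_zero (U.K_Kinv b hb hb')
    (U.Kinv_K b hb hb') (by rw [one_smul]; exact U.K_Kinv_comm b a hb hb' ha ha')
  simpa using this.symm

/-- scalars move past a product -/
theorem wt_prod {A : Type} [Ring A] [Algebra Fq A] (k l x : A) (u v : Fq)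
    (hx : k * x = u • (x * k)) (hy : l * x = v • (x * l)) :
    k * l * x = (u * v) • (x * (k * l)) := by
  rw [mul_assoc, hy, mul_smul_comm, ← mul_assoc, hx, smul_mul_assoc, smul_smul, mul_assoc,
    mul_comm u v]

theorem main_of_H (U : UqGl m n) (a b c : ℕ) (ha : 1 ≤ a) (hab : a < b) (hbc : b < c)
    (hc : c ≤ m + n) (hH : U.br b c c b = U.H b c) :
    U.br a c c b = U.K b * U.Kinv c * U.E a b := by
  have hs : sgn m a c c b = sgn m b c c b := by
    unfold sgn gr; split_ifs <;> first | omega | norm_num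
  unfold br at hH ⊢
  rw [hs, U.def_up a c b ha hab hbc hc,
    abs_comm _ _ _ _ _ _ (U.comm_gen a b b c ha hab (by omega) (by omega) hbc hc (by omega)).eq hH]
  have k1 := U.wt_up b a b (by omega) (by omega) ha hab (by omega)
  have k2 := U.wti_up c a b (by omega) (by omega) ha hab (by omega)
  have k3 := U.wti_up b a b (by omega) (by omega) ha hab (by omega)
  have k4 := U.wt_up c a b (by omega) (by omega) ha hab (by omega)
  have w1 := wt_prod _ _ _ _ _ k1 k2
  have w2 := wt_prod _ _ _ _ _ k3 k4
  have hba : b ≠ a := by omega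
  have hca : c ≠ a := by omega
  have hcb : c ≠ b := by omega
  simp [δℤ, hba, hca, hcb] at w1 w2
  have hp := qi_ne m b
  have hD := Δi_ne m b
  rw [H, smul_mul_assoc, mul_smul_comm, mul_sub, sub_mul, w1, w2, smul_sub, smul_sub, smul_sub,
    smul_smul, smul_smul, smul_smul, smul_smul]
  rw [Δi_eq] at hD ⊢
  exact sc1 _ _ _ hp hD

theorem H_rel (U : UqGl m n) (b c : ℕ) (hb : 1 ≤ b) (hbc : b < c) (hc : c ≤ m + n) :
    U.br b c c b = U.H b c := by
  induction c, hbc using Nat.le_induction with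
  | base =>
    have := U.EF_rel b b hb hc hb hc
    rw [if_pos rfl] at this
    exact this
  | succ d hd ih =>
    have ih := ih (by omega)
    have hd : b < d := hd
    have hs : sgn m b (d+1) (d+1) b = sgn m b (d+1) (d+1) d * sgn m b (d+1) d b := by
      unfold sgn gr; split_ifs <;> first | omega | norm_num
    have hs2 : sgn m d (d+1) (d+1) d = sgn m b (d+1) (d+1) d := by
      unfold sgn gr; split_ifs <;> first | omega | norm_num
    have hs3 : sgn m b d d b = sgn m b (d+1) d b := by
      unfold sgn gr; split_ifs <;> first | omega | norm_num
    have hHd : U.br d (d+1) (d+1) d = U.H d (d+1) := by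
      have := U.EF_rel d d (by omega) hc (by omega) hc
      rw [if_pos rfl] at this
      exact this
    have hf := U.main_of_H b d (d+1) hb hd (by omega) hc hHd
    unfold br at hf ih hHd ⊢
    rw [hs2] at hHd
    rw [hs3] at ih
    have hbd : b ≠ d := by omega
    have hdb : d ≠ b := by omega
    have hbd1 : b ≠ d + 1 := by omega
    have hd1b : d + 1 ≠ b := by omega
    have hp := qi_ne m d
    have hy : U.E b (d+1) * U.E d b - sgn m b (d+1) d b • (U.E d b * U.E b (d+1))
        = (-((Δi m b)⁻¹ * Δi m d * (qi m d)⁻¹)) • (U.Kinv b * U.K d * U.E d (d+1)) := by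
      rw [U.def_up b (d+1) d hb hd (by omega) hc,
        abs_comm2 _ _ _ _ _ _
          (U.comm_gen d (d+1) b d (by omega) (by omega) hc hb hd (by omega) (by omega)).eq ih]
      have k1 := U.wt_up b d (d+1) (by omega) (by omega) (by omega) (by omega) hc
      have k2 := U.wti_up d d (d+1) (by omega) (by omega) (by omega) (by omega) hc
      have k3 := U.wti_up b d (d+1) (by omega) (by omega) (by omega) (by omega) hc
      have k4 := U.wt_up d d (d+1) (by omega) (by omega) (by omega) (by omega) hc
      have w1 := wt_prod _ _ _ _ _ k1 k2
      have w2 := wt_prod _ _ _ _ _ k3 k4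
      simp [δℤ, hbd, hbd1] at w1 w2
      rw [H, smul_mul_assoc, mul_smul_comm, mul_sub, sub_mul, w1, w2, smul_sub, smul_sub, smul_sub,
        smul_smul, smul_smul, smul_smul, smul_smul]
      have hD := Δi_ne m b
      rw [Δi_eq m d]
      exact sc2 _ _ _ _ hp
    have hk : U.E d b * (U.K d * U.Kinv (d+1)) = (qi m d)⁻¹ • (U.K d * U.Kinv (d+1) * U.E d b) := by
      have w := wt_prod _ _ _ _ _ (U.wt_down d b d (by omega) (by omega) hb hd (by omega))
        (U.wti_down (d+1) b d (by omega) hc hb hd (by omega))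
      simp [δℤ, hdb, hd1b] at w
      rw [w, smul_smul, inv_mul_cancel₀ hp, one_smul]
    have hb' : U.E (d+1) d * (U.Kinv b * U.K d) = qi m d • (U.Kinv b * U.K d * U.E (d+1) d) := by
      have w := wt_prod _ _ _ _ _
        (U.wti_down b d (d+1) (by omega) (by omega) (by omega) (by omega) hc)
        (U.wt_down d d (d+1) (by omega) (by omega) (by omega) (by omega) hc)
      simp [δℤ, hbd, hbd1] at w
      rw [w, smul_smul, mul_inv_cancel₀ hp, one_smul]
    rw [hs]
    have key := abs_H _ _ _ _ _ _ _ _ _ _ _ _ _ hp hf hy hk hb' ih hHd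
    rw [← U.def_down b (d+1) d hb hd (by omega) hc] at key
    rw [key]
    have e1 : U.K d * U.Kinv (d+1) * (U.K b * U.Kinv d) = U.K b * U.Kinv (d+1) := by
      rw [mul_assoc, ← mul_assoc (U.Kinv (d+1)),
        ← U.K_Kinv_comm b (d+1) (by omega) (by omega) (by omega) hc, mul_assoc, ← mul_assoc,
        U.K_comm d b (by omega) (by omega) (by omega) (by omega), mul_assoc,
        U.Kinv_comm (d+1) d (by omega) hc (by omega) (by omega), ← mul_assoc (U.K d),
        U.K_Kinv d (by omega) (by omega), one_mul]
    have e2 : U.K d * U.Kinv (d+1) * (U.Kinv b * U.K d) = U.Kinv b * U.K d * (U.K d * U.Kinv (d+1)) := by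
      have c1 : Commute (U.K d) (U.Kinv b) := U.K_Kinv_comm d b (by omega) (by omega) hb (by omega)
      have c2 : Commute (U.Kinv (d+1)) (U.Kinv b) :=
        U.Kinv_comm (d+1) b (by omega) (by omega) hb (by omega)
      have c3 : Commute (U.Kinv (d+1)) (U.K d) :=
        (U.K_Kinv_comm d (d+1) (by omega) (by omega) (by omega) hc).symm
      exact ((c1.mul_left c2).mul_right ((Commute.refl _).mul_left c3)).eq
    have e3 : U.Kinv b * U.K d * (U.Kinv d * U.K (d+1)) = U.Kinv b * U.K (d+1) := by
      rw [mul_assoc, ← mul_assoc (U.K d), U.K_Kinv d (by omega) (by omega), one_mul]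
    have hD := Δi_ne m b
    have hD2 := Δi_ne m d
    simp only [H, mul_smul_comm, mul_sub]
    rw [e1, e2, e3]
    exact sc3 _ _ _ _ _ _ hp hD2

end UqGl

theorem stmt4 (m n : ℕ) (hm : 1 ≤ m) (hn : 1 ≤ n) (U : UqGl m n)
    (a b c : ℕ)
    (h1 : 1 ≤ a) (h2 : a ≤ m + n) (h3 : 1 ≤ b) (h4 : b ≤ m + n)
    (h5 : 1 ≤ c) (h6 : c ≤ m + n)
    (hab : a < b) (hbc : b < c) :
    U.br a c c b = U.K b * U.Kinv c * U.E a b := by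
  exact U.main_of_H a b c h1 hab hbc h6 (U.H_rel b c h3 hbc h6)

end
end

section
/- In U_q[gl(m|n)], for indices with a < c < b < d, the graded commutator satisfies [E^a_b, E^d_c] = −Δ_b K_b^{-1} K_c E^a_c E^d_b. -/
/-!
U_q[gl(m|n)]: the quantum superalgebra presented by generators and relations,
following Zhang (1993).  We work over the field ℚ(q) of rational functions.
-/

noncomputable section

section abstractLemmas

variable {F A : Type*} [Field F] [Ring A] [Algebra F A]

theorem aux_inv (r : F) (hr : r ≠ 0) (k ki x : A) (h1 : k * ki = 1) (h2 : ki * k = 1)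
    (h : k * x = r • (x * k)) : ki * x = r⁻¹ • (x * ki) := by
  have e1 : ki * (k * x) * ki = x * ki := by rw [← mul_assoc, h2, one_mul]
  rw [h] at e1
  have e2 : ki * (r • (x * k)) * ki = r • (ki * x) := by
    rw [mul_smul_comm, smul_mul_assoc, mul_assoc, mul_assoc, h1, mul_one]
  rw [e2] at e1
  rw [← e1, smul_smul, inv_mul_cancel₀ hr, one_smul]

theorem aux_wt_mul (r s : F) (k x y : A) (hx : k * x = r • (x * k)) (hy : k * y = s • (y * k)) :
    k * (x * y) = (r * s) • (x * y * k) := by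
  rw [← mul_assoc, hx, smul_mul_assoc, mul_assoc, hy, mul_smul_comm, smul_smul, mul_assoc]

theorem aux_mul_wt (r s : F) (k l x : A) (hx : k * x = r • (x * k)) (hy : l * x = s • (x * l)) :
    (k * l) * x = (r * s) • (x * (k * l)) := by
  rw [mul_assoc, hy, mul_smul_comm, ← mul_assoc, hx, smul_mul_assoc, smul_smul, mul_assoc, mul_comm]

theorem aux_P (q s D : F) (hq : q ≠ 0) (k ki G B f Fd : A) (hF : Fd = G * f - q • (f * G))
    (hBG : B * G = G * B) (hX : B * f - s • (f * B) = D • (k - ki))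
    (hk : k * G = q • (G * k)) (hki : ki * G = q⁻¹ • (G * ki)) :
    B * Fd - s • (Fd * B) = (-(q - q⁻¹) * D) • (k * G) := by
  have e : B * f = s • (f * B) + D • (k - ki) := by rw [← hX]; abel
  have e1 : B * Fd = G * (B * f) - q • ((B * f) * G) := by
    rw [hF, mul_sub, mul_smul_comm, ← mul_assoc, hBG]; simp only [mul_assoc]
  rw [e1, e, hF]
  simp only [mul_add, add_mul, mul_sub, sub_mul, smul_mul_assoc, mul_smul_comm, mul_assoc, hBG,
    hk, hki, smul_sub, smul_add, smul_smul]
  match_scalars <;> field_simp <;> ring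

theorem aux_Q (q s D : F) (hq : q ≠ 0) (k ki G B f Fd : A) (hF : Fd = G * f - q • (f * G))
    (hBf : B * f = f * B) (hX : B * G - s • (G * B) = D • (k - ki))
    (hk : k * f = q • (f * k)) (hki : ki * f = q⁻¹ • (f * ki)) :
    B * Fd - s • (Fd * B) = ((q - q⁻¹) * D) • (f * ki) := by
  have e : B * G = s • (G * B) + D • (k - ki) := by rw [← hX]; abel
  have e1 : B * Fd = (B * G) * f - q • (f * (B * G)) := by
    rw [hF, mul_sub, mul_smul_comm, ← mul_assoc B f, hBf]; simp only [mul_assoc]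
  rw [e1, e, hF]
  simp only [mul_add, add_mul, mul_sub, sub_mul, smul_mul_assoc, mul_smul_comm, mul_assoc, hBf,
    hk, hki, smul_sub, smul_add, smul_smul]
  match_scalars <;> field_simp <;> ring

theorem aux_X (q s1 s2 Da Dc : F) (hq : q ≠ 0) (hDc : Dc ≠ 0)
    (k1 k1i k2 k2i X B G f Ed Fd : A)
    (hE : Ed = X * B - q⁻¹ • (B * X))
    (hP : X * Fd - s1 • (Fd * X) = (-Dc * Da⁻¹) • (k1 * G))
    (hQ : B * Fd - s2 • (Fd * B) = f * k2i)
    (hXX : X * f - s1 • (f * X) = Da⁻¹ • (k1 - k1i))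
    (hBB : B * G - s2 • (G * B) = Dc⁻¹ • (k2 - k2i))
    (hk1 : k1 * B = q⁻¹ • (B * k1)) (hk2 : k2i * X = q • (X * k2i)) :
    Ed * Fd - (s1 * s2) • (Fd * Ed) = Da⁻¹ • (k1 * k2 - k1i * k2i) := by
  have hk1' : B * k1 = q • (k1 * B) := by
    rw [hk1, smul_smul, mul_inv_cancel₀ hq, one_smul]
  have step : Ed * Fd - (s1 * s2) • (Fd * Ed)
      = X * (B * Fd - s2 • (Fd * B)) + s2 • ((X * Fd - s1 • (Fd * X)) * B)
        - q⁻¹ • (B * (X * Fd - s1 • (Fd * X)) + s1 • ((B * Fd - s2 • (Fd * B)) * X)) := by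
    rw [hE]
    simp only [mul_add, add_mul, mul_sub, sub_mul, smul_mul_assoc, mul_smul_comm, mul_assoc,
      smul_sub, smul_add, smul_smul]
    module
  have t1 : X * (f * k2i) - (q⁻¹ * s1) • (f * k2i * X) = Da⁻¹ • ((k1 - k1i) * k2i) := by
    rw [← smul_mul_assoc Da⁻¹, ← hXX, mul_assoc f, hk2]
    simp only [sub_mul, smul_mul_assoc, mul_smul_comm, mul_assoc, smul_smul]
    match_scalars <;> field_simp
  have t2 : s2 • (k1 * G * B) - q⁻¹ • (B * (k1 * G)) = -(Dc⁻¹ • (k1 * (k2 - k2i))) := by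
    rw [← mul_smul_comm Dc⁻¹, ← hBB, ← mul_assoc B, hk1']
    simp only [mul_sub, smul_mul_assoc, mul_smul_comm, mul_assoc, smul_smul]
    match_scalars <;> field_simp
  rw [step, hP, hQ]
  have t3 : X * (f * k2i) + s2 • ((-Dc * Da⁻¹) • (k1 * G) * B)
        - q⁻¹ • (B * ((-Dc * Da⁻¹) • (k1 * G)) + s1 • (f * k2i * X))
      = (X * (f * k2i) - (q⁻¹ * s1) • (f * k2i * X))
        + (-Dc * Da⁻¹) • (s2 • (k1 * G * B) - q⁻¹ • (B * (k1 * G))) := by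
    simp only [smul_mul_assoc, mul_smul_comm]
    module
  rw [t3, t1, t2]
  simp only [mul_sub, sub_mul]
  match_scalars <;> field_simp <;> ring

theorem aux_final (q s D : F) (hq : q ≠ 0) (k X B G Ed Fd : A)
    (hE : Ed = X * B - q⁻¹ • (B * X)) (hXF : X * Fd = Fd * X) (hXG : X * G = G * X)
    (hY : B * Fd - s • (Fd * B) = D • (k * G)) (hk : k * X = q⁻¹ • (X * k)) :
    Ed * Fd - s • (Fd * Ed) = ((q - q⁻¹) * D) • (k * X * G) := by
  have step : Ed * Fd - s • (Fd * Ed)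
      = X * (B * Fd - s • (Fd * B)) - q⁻¹ • ((B * Fd - s • (Fd * B)) * X) := by
    rw [hE]
    simp only [mul_sub, sub_mul, smul_mul_assoc, mul_smul_comm, mul_assoc, smul_sub, smul_smul, hXF]
    simp only [← mul_assoc, hXF]
    module
  have hk' : X * k = q • (k * X) := by
    rw [hk, smul_smul, mul_inv_cancel₀ hq, one_smul]
  rw [step, hY, mul_smul_comm, smul_mul_assoc, ← mul_assoc, hk', mul_assoc k G, ← hXG,
    smul_mul_assoc, mul_assoc]
  module

end abstractLemmas

theorem qq_ne : qq ≠ 0 := RatFunc.X_ne_zero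

theorem qi_ne (m a : ℕ) : qi m a ≠ 0 := by
  unfold qi; split_ifs
  · exact qq_ne
  · exact inv_ne_zero qq_ne

theorem Δi_eq (m a : ℕ) : Δi m a = qi m a - (qi m a)⁻¹ := by
  unfold Δi gr qi Δq; split_ifs <;> simp

theorem qq_sq_ne : qq - qq⁻¹ ≠ 0 := by
  intro h
  have h2 : qq * qq = 1 := by
    have := sub_eq_zero.mp h
    nth_rewrite 2 [this]
    exact mul_inv_cancel₀ qq_ne
  have h3 : (Polynomial.X * Polynomial.X : Polynomial ℚ) = 1 := by
    apply RatFunc.algebraMap_injective ℚ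
    simpa [qq] using h2
  have := congrArg Polynomial.natDegree h3
  simp at this

theorem Δi_ne (m a : ℕ) : Δi m a ≠ 0 := by
  unfold Δi
  exact mul_ne_zero (pow_ne_zero _ (by norm_num)) qq_sq_ne

namespace UqGl

variable {m n : ℕ} (U : UqGl m n)

theorem wt_raise (i : ℕ) (hi : 1 ≤ i) (hi' : i ≤ m + n) (k : ℕ) : ∀ a, 1 ≤ a → a + k + 1 ≤ m + n →
    U.K i * U.E a (a+k+1) = (qi m i ^ (δℤ i a - δℤ i (a+k+1))) • (U.E a (a+k+1) * U.K i) := by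
  induction k with
  | zero => intro a h1 h2; exact U.K_E_raise i a hi hi' h1 h2
  | succ k ih =>
    intro a h1 h2
    have e1 := U.K_E_raise i a hi hi' h1 (by omega)
    have e2 := ih (a+1) (by omega) (by omega)
    rw [show a + 1 + k + 1 = a + (k+1) + 1 by omega] at e2
    rw [U.nonsimple_def a (a+(k+1)+1) (a+1) h1 (by omega) (by omega) h2 (by omega)]
    have e3 := aux_wt_mul _ _ _ _ _ e1 e2
    have e4 := aux_wt_mul _ _ _ _ _ e2 e1
    rw [mul_comm, ← zpow_add₀ (qi_ne m i)] at e4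
    rw [← zpow_add₀ (qi_ne m i)] at e3
    rw [mul_sub, mul_smul_comm, e3, e4, sub_mul, smul_sub, smul_mul_assoc, smul_comm,
      sub_add_sub_cancel]

theorem wt_lower (i : ℕ) (hi : 1 ≤ i) (hi' : i ≤ m + n) (k : ℕ) : ∀ a, 1 ≤ a → a + k + 1 ≤ m + n →
    U.K i * U.E (a+k+1) a = (qi m i ^ (δℤ i (a+k+1) - δℤ i a)) • (U.E (a+k+1) a * U.K i) := by
  induction k with
  | zero => intro a h1 h2; exact U.K_E_lower i a hi hi' h1 h2
  | succ k ih =>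
    intro a h1 h2
    have e1 := U.K_E_lower i a hi hi' h1 (by omega)
    have e2 := ih (a+1) (by omega) (by omega)
    rw [show a + 1 + k + 1 = a + (k+1) + 1 by omega] at e2
    rw [U.nonsimple_def (a+(k+1)+1) a (a+1) (by omega) h2 h1 (by omega) (by omega)]
    have e3 := aux_wt_mul _ _ _ _ _ e2 e1
    have e4 := aux_wt_mul _ _ _ _ _ e1 e2
    rw [mul_comm, ← zpow_add₀ (qi_ne m i)] at e4
    rw [← zpow_add₀ (qi_ne m i)] at e3
    rw [mul_sub, mul_smul_comm, e3, e4, sub_mul, smul_sub, smul_mul_assoc, smul_comm,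
      sub_add_sub_cancel]

theorem wt (i a b : ℕ) (hi : 1 ≤ i) (hi' : i ≤ m + n) (ha : 1 ≤ a) (ha' : a ≤ m + n)
    (hb : 1 ≤ b) (hb' : b ≤ m + n) (hab : a ≠ b) :
    U.K i * U.E a b = (qi m i ^ (δℤ i a - δℤ i b)) • (U.E a b * U.K i) := by
  rcases lt_or_gt_of_ne hab with h | h
  · obtain ⟨k, rfl⟩ : ∃ k, b = a + k + 1 := ⟨b - a - 1, by omega⟩
    exact U.wt_raise i hi hi' k a ha hb'
  · obtain ⟨k, rfl⟩ : ∃ k, a = b + k + 1 := ⟨a - b - 1, by omega⟩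
    exact U.wt_lower i hi hi' k b hb ha'

theorem wt_inv_s15 (i a b : ℕ) (hi : 1 ≤ i) (hi' : i ≤ m + n) (ha : 1 ≤ a) (ha' : a ≤ m + n)
    (hb : 1 ≤ b) (hb' : b ≤ m + n) (hab : a ≠ b) :
    U.Kinv i * U.E a b = (qi m i ^ (δℤ i a - δℤ i b))⁻¹ • (U.E a b * U.Kinv i) :=
  aux_inv _ (zpow_ne_zero _ (qi_ne m i)) _ _ _ (U.K_Kinv i hi hi') (U.Kinv_K i hi hi')
    (U.wt i a b hi hi' ha ha' hb hb' hab)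

theorem Kinv_K_comm (i j : ℕ) (hi : 1 ≤ i) (hi' : i ≤ m + n) (hj : 1 ≤ j) (hj' : j ≤ m + n) :
    U.Kinv i * U.K j = U.K j * U.Kinv i := by
  have := aux_inv (1 : Fq) one_ne_zero _ _ (U.K j) (U.K_Kinv i hi hi') (U.Kinv_K i hi hi')
    (by rw [one_smul]; exact U.K_comm i j hi hi' hj hj')
  simpa using this

/-- weights of `K_i K_j⁻¹` -/
theorem wt2 (i j a b : ℕ) (hi : 1 ≤ i) (hi' : i ≤ m + n) (hj : 1 ≤ j) (hj' : j ≤ m + n)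
    (ha : 1 ≤ a) (ha' : a ≤ m + n) (hb : 1 ≤ b) (hb' : b ≤ m + n) (hab : a ≠ b) :
    (U.K i * U.Kinv j) * U.E a b =
      (qi m i ^ (δℤ i a - δℤ i b) * (qi m j ^ (δℤ j a - δℤ j b))⁻¹)
        • (U.E a b * (U.K i * U.Kinv j)) :=
  aux_mul_wt _ _ _ _ _ (U.wt i a b hi hi' ha ha' hb hb' hab)
    (U.wt_inv_s15 j a b hj hj' ha ha' hb hb' hab)

theorem wt2' (i j a b : ℕ) (hi : 1 ≤ i) (hi' : i ≤ m + n) (hj : 1 ≤ j) (hj' : j ≤ m + n)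
    (ha : 1 ≤ a) (ha' : a ≤ m + n) (hb : 1 ≤ b) (hb' : b ≤ m + n) (hab : a ≠ b) :
    (U.Kinv i * U.K j) * U.E a b =
      ((qi m i ^ (δℤ i a - δℤ i b))⁻¹ * qi m j ^ (δℤ j a - δℤ j b))
        • (U.E a b * (U.Kinv i * U.K j)) :=
  aux_mul_wt _ _ _ _ _ (U.wt_inv_s15 i a b hi hi' ha ha' hb hb' hab)
    (U.wt j a b hj hj' ha ha' hb hb' hab)

/-- A property closed under products and linear combinations holds on all raising generators. -/
theorem raise_ind (S : Subalgebra Fq U.A) (k : ℕ) : ∀ a, 1 ≤ a → a + k + 1 ≤ m + n →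
    (∀ i, a ≤ i → i < a + k + 1 → U.E i (i+1) ∈ S) → U.E a (a+k+1) ∈ S := by
  induction k with
  | zero => intro a _ _ h; exact h a le_rfl (by omega)
  | succ k ih =>
    intro a h1 h2 h
    have e1 := h a le_rfl (by omega)
    have e2 := ih (a+1) (by omega) (by omega) (fun i _ _ => h i (by omega) (by omega))
    rw [show a + 1 + k + 1 = a + (k+1) + 1 by omega] at e2
    rw [U.nonsimple_def a (a+(k+1)+1) (a+1) h1 (by omega) (by omega) h2 (by omega)]
    exact S.sub_mem (S.mul_mem e1 e2) (S.smul_mem (S.mul_mem e2 e1) _)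

theorem lower_ind (S : Subalgebra Fq U.A) (k : ℕ) : ∀ a, 1 ≤ a → a + k + 1 ≤ m + n →
    (∀ i, a ≤ i → i < a + k + 1 → U.E (i+1) i ∈ S) → U.E (a+k+1) a ∈ S := by
  induction k with
  | zero => intro a _ _ h; exact h a le_rfl (by omega)
  | succ k ih =>
    intro a h1 h2 h
    have e1 := h a le_rfl (by omega)
    have e2 := ih (a+1) (by omega) (by omega) (fun i _ _ => h i (by omega) (by omega))
    rw [show a + 1 + k + 1 = a + (k+1) + 1 by omega] at e2
    rw [U.nonsimple_def (a+(k+1)+1) a (a+1) (by omega) h2 h1 (by omega) (by omega)]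
    exact S.sub_mem (S.mul_mem e2 e1) (S.smul_mem (S.mul_mem e1 e2) _)

theorem simple_comm (i j : ℕ) (hi : 1 ≤ i) (hi' : i + 1 ≤ m + n) (hj : 1 ≤ j)
    (hj' : j + 1 ≤ m + n) (hij : i ≠ j) :
    U.E i (i+1) * U.E (j+1) j = U.E (j+1) j * U.E i (i+1) := by
  have h := U.EF_rel i j hi hi' hj hj'
  have hs : sgn m i (i+1) (j+1) j = 1 := by
    unfold sgn gr
    split_ifs <;> first | omega | norm_num
  rw [if_neg hij, zero_smul, hs, one_smul] at h
  exact sub_eq_zero.mp h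

/-- Raising and lowering generators with disjoint supports commute. -/
theorem disj (a b c d : ℕ) (ha : 1 ≤ a) (hab : a < b) (hb : b ≤ m + n)
    (hc : 1 ≤ c) (hcd : c < d) (hd : d ≤ m + n) (h : b ≤ c ∨ d ≤ a) :
    U.E a b * U.E d c = U.E d c * U.E a b := by
  obtain ⟨k, rfl⟩ : ∃ k, b = a + k + 1 := ⟨b - a - 1, by omega⟩
  obtain ⟨l, rfl⟩ : ∃ l, d = c + l + 1 := ⟨d - c - 1, by omega⟩
  have key := U.raise_ind (Subalgebra.centralizer Fq {U.E (c+l+1) c}) k a ha hb (by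
    intro i h1 h2
    rw [Subalgebra.mem_centralizer_iff]
    intro g hg
    rw [Set.mem_singleton_iff] at hg
    subst hg
    have key2 := U.lower_ind (Subalgebra.centralizer Fq {U.E i (i+1)}) l c hc hd (by
      intro j h3 h4
      rw [Subalgebra.mem_centralizer_iff]
      intro g hg
      rw [Set.mem_singleton_iff] at hg
      subst hg
      exact U.simple_comm i j (by omega) (by omega) (by omega) (by omega) (by omega))
    rw [Subalgebra.mem_centralizer_iff] at key2
    exact (key2 _ rfl).symm)
  rw [Subalgebra.mem_centralizer_iff] at key
  exact (key _ rfl).symm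

theorem def_raise (a c b : ℕ) (ha : 1 ≤ a) (hac : a < c) (hcb : c < b) (hb : b ≤ m + n) :
    U.E a b = U.E a c * U.E c b - (qi m c)⁻¹ • (U.E c b * U.E a c) := by
  have := U.nonsimple_def a b c ha (by omega) (by omega) hb (by omega)
  rwa [if_neg (by omega)] at this

theorem def_lower (a c b : ℕ) (ha : 1 ≤ a) (hac : a < c) (hcb : c < b) (hb : b ≤ m + n) :
    U.E b a = U.E b c * U.E c a - qi m c • (U.E c a * U.E b c) := by
  have := U.nonsimple_def b a c (by omega) hb ha (by omega) (by omega)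
  rwa [if_pos (by omega)] at this

/-- `[E^c_b, E^b_c]` -/
def XRel (c b : ℕ) : Prop :=
  U.E c b * U.E b c - sgn m c b b c • (U.E b c * U.E c b) =
    (Δi m c)⁻¹ • (U.K c * U.Kinv b - U.Kinv c * U.K b)

theorem P_rel (c b d : ℕ) (hc : 1 ≤ c) (hcb : c < b) (hbd : b < d) (hd : d ≤ m + n)
    (hX : U.XRel c b) :
    U.E c b * U.E d c - sgn m c b b c • (U.E d c * U.E c b) =
      (-Δi m b * (Δi m c)⁻¹) • (U.K c * U.Kinv b * U.E d b) := by
  rw [Δi_eq m b]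
  refine aux_P (qi m b) _ _ (qi_ne m b) _ (U.Kinv c * U.K b) _ _ _ _
    (U.def_lower c b d hc hcb hbd hd)
    (U.disj c b b d hc hcb (by omega) (by omega) hbd hd (by omega)) hX ?_ ?_
  · rw [U.wt2 c b d b (by omega) (by omega) (by omega) (by omega) (by omega) (by omega)
      (by omega) (by omega) (by omega)]
    simp [δℤ, show c ≠ d by omega, show c ≠ b by omega, show b ≠ d by omega]
  · rw [U.wt2' c b d b (by omega) (by omega) (by omega) (by omega) (by omega) (by omega)
      (by omega) (by omega) (by omega)]
    simp [δℤ, show c ≠ d by omega, show c ≠ b by omega, show b ≠ d by omega]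

theorem Q_rel (a c b : ℕ) (ha : 1 ≤ a) (hac : a < c) (hcb : c < b) (hb : b ≤ m + n)
    (hX : U.XRel c b) :
    U.E c b * U.E b a - sgn m c b b c • (U.E b a * U.E c b) =
      U.E c a * (U.Kinv c * U.K b) := by
  have := aux_Q (qi m c) (sgn m c b b c) ((Δi m c)⁻¹) (qi_ne m c) (U.K c * U.Kinv b)
    (U.Kinv c * U.K b) _ _ _ _
    (U.def_lower a c b ha hac hcb hb)
    (U.disj c b a c (by omega) hcb (by omega) (by omega) hac (by omega) (by omega)) hX (by
      rw [U.wt2 c b c a (by omega) (by omega) (by omega) (by omega) (by omega) (by omega)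
        (by omega) (by omega) (by omega)]
      simp [δℤ, show c ≠ a by omega, show b ≠ c by omega, show b ≠ a by omega]) (by
      rw [U.wt2' c b c a (by omega) (by omega) (by omega) (by omega) (by omega) (by omega)
        (by omega) (by omega) (by omega)]
      simp [δℤ, show c ≠ a by omega, show b ≠ c by omega, show b ≠ a by omega])
  rw [this, ← Δi_eq, mul_inv_cancel₀ (Δi_ne m c), one_smul]

theorem X_rel (k : ℕ) : ∀ a, 1 ≤ a → a + k + 1 ≤ m + n → U.XRel a (a+k+1) := by
  induction k with
  | zero =>
    intro a h1 h2
    have := U.EF_rel a a h1 h2 h1 h2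
    rw [if_pos rfl] at this
    exact this
  | succ k ih =>
    intro a h1 h2
    have x1 : U.XRel a (a+1) := by
      have := U.EF_rel a a h1 (by omega) h1 (by omega)
      rw [if_pos rfl] at this
      exact this
    have x2 := ih (a+1) (by omega) (by omega)
    rw [show a + 1 + k + 1 = a + (k+1) + 1 by omega] at x2
    generalize hb : a + (k+1) + 1 = b at *
    generalize hc : a + 1 = c at *
    have hs : sgn m a b b a = sgn m a c c a * sgn m c b b c := by
      unfold sgn gr
      split_ifs <;> first | omega | norm_num
    unfold XRel
    rw [hs]
    have key := aux_X (qi m c) (sgn m a c c a) (sgn m c b b c) (Δi m a) (Δi m c) (qi_ne m c)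
      (Δi_ne m c) (U.K a * U.Kinv c) (U.Kinv a * U.K c) (U.K c * U.Kinv b) (U.Kinv c * U.K b)
      _ _ (U.E b c) (U.E c a) _ (U.E b a) (U.def_raise a c b h1 (by omega) (by omega) h2)
      (U.P_rel a c b h1 (by omega) (by omega) h2 x1)
      (U.Q_rel a c b h1 (by omega) (by omega) h2 x2) x1 x2 (by
        rw [U.wt2 a c c b (by omega) (by omega) (by omega) (by omega) (by omega) (by omega)
          (by omega) (by omega) (by omega)]
        simp [δℤ, show a ≠ c by omega, show a ≠ b by omega, show c ≠ b by omega]) (by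
        rw [U.wt2' c b a c (by omega) (by omega) (by omega) (by omega) (by omega) (by omega)
          (by omega) (by omega) (by omega)]
        simp [δℤ, show c ≠ a by omega, show b ≠ a by omega, show b ≠ c by omega])
    rw [key]
    congr 2
    · rw [mul_assoc, ← mul_assoc (U.Kinv c), U.Kinv_K c (by omega) (by omega), one_mul]
    · rw [mul_assoc, ← mul_assoc (U.K c), U.K_Kinv c (by omega) (by omega), one_mul]

end UqGl

theorem stmt15 (m n : ℕ) (hm : 1 ≤ m) (hn : 1 ≤ n) (U : UqGl m n)
    (a b c d : ℕ)
    (h1 : 1 ≤ a) (h2 : a ≤ m + n) (h3 : 1 ≤ b) (h4 : b ≤ m + n)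
    (h5 : 1 ≤ c) (h6 : c ≤ m + n) (h7 : 1 ≤ d) (h8 : d ≤ m + n)
    (hac : a < c) (hcb : c < b) (hbd : b < d) :
    U.br a b d c = (-Δi m b) • (U.Kinv b * U.K c * U.E a c * U.E d b) := by
  have hX : U.XRel c b := by
    obtain ⟨k, rfl⟩ : ∃ k, b = c + k + 1 := ⟨b - c - 1, by omega⟩
    exact U.X_rel k c h5 h4
  have hP := U.P_rel c b d h5 hcb hbd h8 hX
  have hs : sgn m a b d c = sgn m c b b c := by
    unfold sgn gr
    split_ifs <;> first | omega | norm_num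
  unfold UqGl.br
  rw [hs, aux_final (qi m c) _ _ (qi_ne m c) _ _ _ _ _ _ (U.def_raise a c b h1 hac hcb h4)
    (U.disj a c c d h1 hac h6 h5 (by omega) h8 (by omega))
    (U.disj a c b d h1 hac h6 h3 hbd h8 (by omega)) hP (by
      rw [U.wt2 c b a c h5 h6 h3 h4 h1 h2 h5 h6 (by omega)]
      simp [δℤ, show c ≠ a by omega, show b ≠ a by omega, show b ≠ c by omega]),
    ← Δi_eq, U.Kinv_K_comm b c h3 h4 h5 h6]
  congr 1
  field_simp [Δi_ne m c]

end
end
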